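/- arXiv:2002.11536 — 3 statements merged into one kernel-verified Lean document; each statement's English description precedes it below -/
import Mathlib

section
/- For all integers n ≥ 1 and p ≥ 0, p! · P(n,p) = ∑_{j=0}^{p} (-1)^{p-j} · (p choose j) · j^n; equivalently, P(n,p) = (1/p!) ∑_{j=1}^{p} (-1)^{p-j} · (p!/(j!(p-j)!)) · j^n, the Stirling number of the second kind. -/
/-- `P n p` is the number of partitions of the `n`-element set `Fin n` into exactly `p`
nonempty blocks, formalized as the number of `Finpartition`s of `Finset.univ : Finset (Fin n)`
having exactly `p` parts. -/
noncomputable def P (n p : ℕ) : ℕ :=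
  Nat.card {π : Finpartition (Finset.univ : Finset (Fin n)) // π.parts.card = p}

open Finset in
/-- The number of surjections between finite types, by inclusion-exclusion. -/
theorem natCard_surjective_eq_sum (α β : Type*) [Fintype α] [Fintype β] :
    (Nat.card {f : α → β // Function.Surjective f} : ℤ) =
      ∑ j ∈ range (Fintype.card β + 1),
        (-1) ^ (Fintype.card β - j) * ((Fintype.card β).choose j : ℤ) *
          (j : ℤ) ^ Fintype.card α := by
  classical
  have hsurj : Nat.card {f : α → β // Function.Surjective f} =
      #(univ.inf fun b : β ↦ (univ.filter fun f : α → β ↦ ∀ a, f a ≠ b)ᶜ) := 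
    Nat.subtype_card _ fun f ↦ by simp [Finset.mem_inf, Function.Surjective]
  have havoid (t : Finset β) :
      #(t.inf fun b : β ↦ univ.filter fun f : α → β ↦ ∀ a, f a ≠ b) =
        (Fintype.card β - #t) ^ Fintype.card α := by
    have : (t.inf fun b : β ↦ univ.filter fun f : α → β ↦ ∀ a, f a ≠ b) =
        Fintype.piFinset fun _ : α ↦ tᶜ := by
      ext f
      simp only [Finset.mem_inf, mem_filter, mem_univ, true_and, Fintype.mem_piFinset, mem_compl]
      exact ⟨fun h a ha ↦ h _ ha a rfl, fun h b hb a hab ↦ h a (hab ▸ hb)⟩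
    rw [this, Fintype.card_piFinset, prod_const, card_univ, card_compl]
  rw [hsurj, inclusion_exclusion_card_inf_compl]
  simp_rw [havoid]
  rw [sum_powerset_apply_card
    (fun m ↦ (-1 : ℤ) ^ m * (((Fintype.card β - m) ^ Fintype.card α : ℕ) : ℤ)), card_univ,
    ← sum_range_reflect]
  refine sum_congr rfl fun j hj ↦ ?_
  have hj : j ≤ Fintype.card β := by simpa [Nat.lt_succ_iff] using hj
  rw [Nat.add_sub_cancel, Nat.choose_symm hj, Nat.sub_sub_self hj, nsmul_eq_mul]
  push_cast
  ring

namespace Finpartition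

variable {α β : Type*} [Fintype α] [DecidableEq α]

/-- The map sending each element to the label of its block. -/
def labelMap (π : Finpartition (Finset.univ : Finset α)) (e : π.parts ≃ β) (a : α) : β :=
  e ⟨π.part a, π.part_mem.2 (Finset.mem_univ a)⟩

theorem labelMap_eq_iff (π : Finpartition (Finset.univ : Finset α)) (e : π.parts ≃ β)
    (a : α) (b : β) : π.labelMap e a = b ↔ a ∈ (e.symm b : Finset α) := by
  rw [labelMap, ← Equiv.eq_symm_apply, Subtype.ext_iff]
  exact π.part_eq_iff_mem (e.symm b).2

theorem labelMap_surjective (π : Finpartition (Finset.univ : Finset α)) (e : π.parts ≃ β) :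
    Function.Surjective (π.labelMap e) := fun b ↦ by
  obtain ⟨a, ha⟩ := π.nonempty_of_mem_parts (e.symm b).2
  exact ⟨a, (π.labelMap_eq_iff e a b).2 ha⟩

theorem eq_of_labelMap_eq {π ρ : Finpartition (Finset.univ : Finset α)} {e : π.parts ≃ β}
    {e' : ρ.parts ≃ β} (h : π.labelMap e = ρ.labelMap e') : π = ρ ∧ e ≍ e' := by
  have hsymm (b : β) : (e.symm b : Finset α) = e'.symm b := by
    ext a
    rw [← labelMap_eq_iff, ← labelMap_eq_iff, h]
  have hπ : π = ρ := by
    ext s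
    constructor
    · intro hs
      have : s = e'.symm (e ⟨s, hs⟩) := by rw [← hsymm, Equiv.symm_apply_apply]
      exact this.symm ▸ (e'.symm (e ⟨s, hs⟩)).2
    · intro hs
      have : (e.symm (e' ⟨s, hs⟩) : Finset α) = s := by rw [hsymm, Equiv.symm_apply_apply]
      exact this ▸ (e.symm (e' ⟨s, hs⟩)).2
  subst hπ
  refine ⟨rfl, heq_of_eq ?_⟩
  rw [← Equiv.symm_bijective.injective.eq_iff]
  exact Equiv.ext fun b ↦ Subtype.ext (hsymm b)

theorem exists_labelMap_eq {f : α → β} (hf : Function.Surjective f) :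
    ∃ (π : Finpartition (Finset.univ : Finset α)) (e : π.parts ≃ β), π.labelMap e = f := by
  classical
  have : Fintype β := Fintype.ofSurjective f hf
  let fiber (b : β) : Finset α := Finset.univ.filter fun a ↦ f a = b
  have mem_fiber (a : α) (b : β) : a ∈ fiber b ↔ f a = b := by simp [fiber]
  have fiber_inj : Function.Injective fiber := fun b c hbc ↦ by
    obtain ⟨a, rfl⟩ := hf b
    rw [← mem_fiber, ← hbc, mem_fiber]
  let π : Finpartition (Finset.univ : Finset α) :=
    ofExistsUnique (Finset.univ.image fiber) (fun s _ ↦ s.subset_univ)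
      (fun a _ ↦ ⟨fiber (f a), by simp [mem_fiber], by
        rintro s ⟨hs, ha⟩
        obtain ⟨b, -, rfl⟩ := Finset.mem_image.1 hs
        rw [(mem_fiber a b).1 ha]⟩)
      (fun h ↦ by
        obtain ⟨b, -, hb⟩ := Finset.mem_image.1 h
        obtain ⟨a, rfl⟩ := hf b
        exact Finset.notMem_empty a (hb ▸ (mem_fiber a (f a)).2 rfl))
  let e : β ≃ π.parts := Equiv.ofBijective
    (fun b ↦ ⟨fiber b, Finset.mem_image_of_mem _ (Finset.mem_univ b)⟩)
    ⟨fun b c h ↦ fiber_inj (Subtype.ext_iff.1 h), fun ⟨s, hs⟩ ↦ by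
      obtain ⟨b, -, rfl⟩ := Finset.mem_image.1 hs
      exact ⟨b, rfl⟩⟩
  refine ⟨π, e.symm, funext fun a ↦ ?_⟩
  rw [labelMap_eq_iff]
  exact (mem_fiber a (f a)).2 rfl

/-- Surjections onto `Fin p` are partitions into `p` blocks together with a labelling of the
blocks. -/
theorem factorial_mul_natCard_eq_natCard_surjective (α : Type*) [Fintype α] [DecidableEq α]
    (p : ℕ) :
    p.factorial * Nat.card {π : Finpartition (Finset.univ : Finset α) // π.parts.card = p} =
      Nat.card {f : α → Fin p // Function.Surjective f} := by
  let F : (Σ π : {π : Finpartition (Finset.univ : Finset α) // π.parts.card = p},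
      π.1.parts ≃ Fin p) → {f : α → Fin p // Function.Surjective f} :=
    fun x ↦ ⟨x.1.1.labelMap x.2, x.1.1.labelMap_surjective x.2⟩
  have hF : Function.Bijective F := by
    constructor
    · rintro ⟨⟨π, hπ⟩, e⟩ ⟨⟨ρ, hρ⟩, e'⟩ h
      obtain ⟨hπρ, he⟩ : π = ρ ∧ e ≍ e' := eq_of_labelMap_eq (Subtype.ext_iff.1 h)
      subst hπρ
      rw [eq_of_heq he]
    · rintro ⟨f, hf⟩
      obtain ⟨π, e, rfl⟩ := exists_labelMap_eq hf
      exact ⟨⟨⟨π, by simpa using Fintype.card_congr e⟩, e⟩, rfl⟩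
  rw [← Nat.card_eq_of_bijective F hF, Nat.card_sigma]
  have hlabel (π : {π : Finpartition (Finset.univ : Finset α) // π.parts.card = p}) :
      Nat.card (π.1.parts ≃ Fin p) = p.factorial := by
    rw [Nat.card_eq_fintype_card, Fintype.card_equiv (π.1.parts.equivFinOfCardEq π.2),
      Fintype.card_coe, π.2]
  simp_rw [hlabel]
  rw [Finset.sum_const, Finset.card_univ, Nat.card_eq_fintype_card, smul_eq_mul, mul_comm]

end Finpartition

theorem stirling_formula (n p : ℕ) (hn : 1 ≤ n) :
    (Nat.factorial p : ℤ) * (P n p : ℤ) =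
      ∑ j ∈ Finset.range (p + 1), (-1) ^ (p - j) * (Nat.choose p j : ℤ) * (j : ℤ) ^ n := by
  rw [P, ← Nat.cast_mul, Finpartition.factorial_mul_natCard_eq_natCard_surjective,
    natCard_surjective_eq_sum, Fintype.card_fin, Fintype.card_fin]
end

section
/- Let g : Fin n → Fin p be an assignment of n items to p groups, with n_k the number of items i such that g(i) = k. Let Y : Fin n → Fin n → Prop be a decidable relation such that Y i j implies g(i) = g(j) for all i, j, and suppose the number of ordered pairs (i,j) with Y i j equals ∑_{k} n_k². Then for all i, j: Y i j holds if and only if g(i) = g(j). -/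
/-- The number of pairs in the kernel of `g` is the sum of the squared fibre sizes. -/
theorem card_filter_apply_eq_apply {α β : Type*} [Fintype α] [Fintype β] [DecidableEq β]
    (g : α → β) :
    (Finset.univ.filter (fun ij : α × α => g ij.1 = g ij.2)).card =
      ∑ k : β, (Finset.univ.filter (fun i : α => g i = k)).card ^ 2 := by
  rw [Finset.card_eq_sum_card_fiberwise (f := fun ij => g ij.1) (t := Finset.univ)
    (fun _ _ => Finset.mem_coe.2 (Finset.mem_univ _))]
  refine Finset.sum_congr rfl fun k _ => ?_
  rw [sq, ← Finset.card_product]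
  congr 1
  ext ⟨i, j⟩
  simp only [Finset.mem_filter, Finset.mem_univ, true_and, Finset.mem_product]
  grind

theorem blp_constraint_forces_same_group (n p : ℕ) (g : Fin n → Fin p)
    (Y : Fin n → Fin n → Prop) [DecidableRel Y]
    (hY : ∀ i j, Y i j → g i = g j)
    (hcard : (Finset.univ.filter (fun ij : Fin n × Fin n => Y ij.1 ij.2)).card =
      ∑ k : Fin p, (Finset.univ.filter (fun i : Fin n => g i = k)).card ^ 2) :
    ∀ i j, Y i j ↔ g i = g j := by
  have hsub : Finset.univ.filter (fun ij : Fin n × Fin n => Y ij.1 ij.2) ⊆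
      Finset.univ.filter (fun ij : Fin n × Fin n => g ij.1 = g ij.2) :=
    Finset.monotone_filter_right _ fun ij _ h => hY ij.1 ij.2 h
  have heq := Finset.eq_of_subset_of_card_le hsub
    (by rw [hcard, card_filter_apply_eq_apply])
  intro i j
  simpa using Finset.ext_iff.1 heq (i, j)
end

section
/- Fix group sizes n₁,…,n_p with n₁ + ⋯ + n_p = n, and define the block-diagonal cost matrix c : Fin n → Fin n → ℝ by c i j = 1 if i and j lie in the same diagonal block (i.e., there is a k such that both i and j have indices in the half-open interval [N_{k-1}, N_k), where N_k = n₁ + ⋯ + n_k and N₀ = 0) and c i j = 0 otherwise. Let d : Fin n → Fin n → ℝ satisfy d i i = 0 for all i. Then the minimum over all permutations σ of Fin n of the quadratic assignment objective ∑_{i} ∑_{j} c i j · d (σ i) (σ j) equals the minimum, over all assignments g : Fin n → Fin p whose group k has exactly n_k items, of the intra-group objective ∑_{(i,j) : i ≠ j, g(i) = g(j)} d i j. -/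
theorem Fin.exists_block_map (p : ℕ) (m N : Fin p → ℕ)
    (hN : ∀ k, N k = ∑ l ∈ Finset.univ.filter (fun l => l < k), m l) :
    ∃ b : Fin (∑ k, m k) → Fin p,
      (∀ i k, b i = k ↔ N k ≤ (i : ℕ) ∧ (i : ℕ) < N k + m k) ∧
      ∀ k, Fintype.card {i // b i = k} = m k := by
  have hmono : ∀ k l, k < l → N k + m k ≤ N l := by
    intro k l hkl
    rw [hN k, hN l, add_comm, ← Finset.sum_insert (by simp)]
    apply Finset.sum_le_sum_of_subset
    intro x hx
    simp only [Finset.mem_insert, Finset.mem_filter, Finset.mem_univ, true_and] at hx ⊢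
    rcases hx with rfl | hx
    · exact hkl
    · exact hx.trans hkl
  have hN' : ∀ k : Fin p, N k = ∑ j : Fin (k : ℕ), m (Fin.castLE k.2.le j) := by
    intro k
    rw [hN k]
    symm
    refine Finset.sum_bij (fun j _ => Fin.castLE k.2.le j) ?_ ?_ ?_ ?_
    · intro j _
      exact Finset.mem_filter.2 ⟨Finset.mem_univ _, j.2⟩
    · intro j _ j' _ h
      simpa [Fin.ext_iff] using h
    · intro l hl
      exact ⟨⟨l, by simpa using hl⟩, by simp, rfl⟩
    · intro j _
      rfl
  have hmem : ∀ i : Fin (∑ k, m k),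
      N (finSigmaFinEquiv.symm i).1 ≤ (i : ℕ) ∧
        (i : ℕ) < N (finSigmaFinEquiv.symm i).1 + m (finSigmaFinEquiv.symm i).1 := by
    intro i
    have h := finSigmaFinEquiv_apply (finSigmaFinEquiv.symm i)
    rw [Equiv.apply_symm_apply, ← hN'] at h
    have := (finSigmaFinEquiv.symm i).2.2
    omega
  refine ⟨fun i => (finSigmaFinEquiv.symm i).1, fun i k => ⟨?_, fun h => ?_⟩, fun k => ?_⟩
  · rintro rfl
    exact hmem i
  · have h' := hmem i
    rcases lt_trichotomy (finSigmaFinEquiv.symm i).1 k with hlt | heq | hlt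
    · have := hmono _ _ hlt
      omega
    · exact heq
    · have := hmono _ _ hlt
      omega
  · rw [Fintype.card_congr ((finSigmaFinEquiv.symm.subtypeEquiv fun _ => Iff.rfl).trans
      (Equiv.sigmaSubtype k)), Fintype.card_fin]

theorem sum_offDiag_fiber_eq_sum_perm {ι κ : Type*} [Fintype ι] [DecidableEq ι] [DecidableEq κ]
    (d : ι → ι → ℝ) (hdiag : ∀ i, d i i = 0) (b g : ι → κ) (σ : Equiv.Perm ι)
    (hσ : ∀ i, g (σ i) = b i) :
    ∑ i, ∑ j, (if b i = b j then (1 : ℝ) else 0) * d (σ i) (σ j) =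
      ∑ ij ∈ Finset.univ.filter (fun ij : ι × ι => ij.1 ≠ ij.2 ∧ g ij.1 = g ij.2),
        d ij.1 ij.2 := by
  simp only [← hσ]
  rw [Equiv.sum_comp σ (fun x => ∑ j, (if g x = g (σ j) then (1 : ℝ) else 0) * d x (σ j)),
    Finset.sum_filter, Fintype.sum_prod_type]
  refine Finset.sum_congr rfl fun i _ => ?_
  rw [Equiv.sum_comp σ (fun y => (if g i = g y then (1 : ℝ) else 0) * d i y)]
  refine Finset.sum_congr rfl fun j _ => ?_
  by_cases hij : i = j
  · simp [hij, hdiag]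
  · simp [hij]

open Finset in
/-- The fixed-group-size grouping problem (Model A) is equivalent to a quadratic
assignment problem with a block-diagonal 0/1 cost matrix whose `k`-th diagonal block
has size `nn k`. -/
theorem qap_formulation_of_fixed_size_grouping (n p : ℕ) (nn : Fin p → ℕ)
    (hsum : ∑ k : Fin p, nn k = n) (d : Fin n → Fin n → ℝ) (hdiag : ∀ i, d i i = 0)
    -- `N k` is the partial sum `n₁ + ⋯ + n_{k-1}`, so block `k` occupies indices in `[N k, N k + nn k)`
    (N : Fin p → ℕ) (hN : ∀ k, N k = ∑ l ∈ univ.filter (fun l => l < k), nn l)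
    -- the block-diagonal cost matrix
    (c : Fin n → Fin n → ℝ)
    (hc : ∀ i j, c i j =
      if ∃ k : Fin p, (N k ≤ (i : ℕ) ∧ (i : ℕ) < N k + nn k) ∧
          (N k ≤ (j : ℕ) ∧ (j : ℕ) < N k + nn k) then 1 else 0) :
    sInf {x : ℝ | ∃ σ : Equiv.Perm (Fin n),
        x = ∑ i : Fin n, ∑ j : Fin n, c i j * d (σ i) (σ j)} =
      sInf {x : ℝ | ∃ g : Fin n → Fin p,
        (∀ k : Fin p, (univ.filter (fun i : Fin n => g i = k)).card = nn k) ∧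
        x = ∑ ij ∈ univ.filter (fun ij : Fin n × Fin n => ij.1 ≠ ij.2 ∧ g ij.1 = g ij.2),
          d ij.1 ij.2} := by
  subst hsum
  obtain ⟨b, hb, hcard⟩ := Fin.exists_block_map p nn N hN
  have hc' : ∀ i j, c i j = if b i = b j then 1 else 0 := by
    intro i j
    rw [hc]
    refine if_congr ?_ rfl rfl
    simp only [← hb]
    exact ⟨fun ⟨_, hi, hj⟩ => hi.trans hj.symm, fun h => ⟨b j, h, rfl⟩⟩
  simp only [hc']
  congr 1
  ext x
  constructor
  · rintro ⟨σ, rfl⟩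
    refine ⟨b ∘ σ.symm, fun k => ?_, sum_offDiag_fiber_eq_sum_perm d hdiag b _ σ (by simp)⟩
    rw [← Fintype.card_subtype, ← hcard k]
    exact Fintype.card_congr (σ.symm.subtypeEquiv fun _ => Iff.rfl)
  · rintro ⟨g, hg, rfl⟩
    have e : ∀ k, {i // b i = k} ≃ {i // g i = k} := fun k =>
      Fintype.equivOfCardEq (by rw [hcard, Fintype.card_subtype, hg])
    exact ⟨Equiv.ofFiberEquiv e,
      (sum_offDiag_fiber_eq_sum_perm d hdiag b g _ (Equiv.ofFiberEquiv_map e)).symm⟩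
end
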